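/- Let 0 < e_0 ≤ 1, 1 ≤ m_1 ≤ m, with machines modeled as follows: for i < m_1, A_i : ℝ → ℝ with A_i(0) = 0 and e_0·(t − s) ≤ A_i(t) − A_i(s) ≤ t − s for all 0 ≤ s ≤ t; for the remaining i, A_i with A_i(0) = 0, A_i(t) − A_i(s) ≤ t − s for 0 ≤ s ≤ t, strictly increasing and unbounded; g_i(w) = sInf {t ≥ 0 : A_i(t) ≥ w}. Let p : Fin n → ℝ with p_1 ≥ p_2 ≥ … ≥ p_n > 0 and let 1 ≤ d ≤ n. Let σ* be an assignment attaining the optimal makespan C* = min over assignments τ of max_i g_i(∑_{j : τ j = i} p_j). Suppose σ : Fin n → Fin m agrees with σ* on jobs 1, …, d and assigns jobs d+1, …, n in order by the ECT rule: for every job k > d and every machine i, g_{σ k}(L_{σ k}^{<k}(σ) + p_k) ≤ g_i(L_i^{<k}(σ) + p_k), where L_i^{<k}(σ) = ∑_{j < k, σ j = i} p_j. Then C_max(σ) = max_i g_i(∑_{j : σ j = i} p_j) ≤ (1 + m·(m + m_1 − 1)/(d·e_0·m_1))·C*. -/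

import Mathlib

noncomputable def finish (A : ℝ → ℝ) (w : ℝ) : ℝ := sInf {t : ℝ | 0 ≤ t ∧ w ≤ A t}

noncomputable def load {n m : ℕ} (p : Fin n → ℝ) (σ : Fin n → Fin m) (i : Fin m) : ℝ :=
  ∑ j ∈ Finset.univ.filter (fun j => σ j = i), p j

noncomputable def prefLoad {n m : ℕ} (p : Fin n → ℝ) (σ : Fin n → Fin m) (i : Fin m)
    (k : Fin n) : ℝ :=
  ∑ j ∈ Finset.univ.filter (fun j => j < k ∧ σ j = i), p j

noncomputable def makespan {n m : ℕ} (hm : 0 < m) (A : Fin m → ℝ → ℝ) (p : Fin n → ℝ)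
    (σ : Fin n → Fin m) : ℝ :=
  Finset.univ.sup' ⟨⟨0, hm⟩, Finset.mem_univ _⟩ (fun i => finish (A i) (load p σ i))

noncomputable def optMakespan {n m : ℕ} (hm : 0 < m) (A : Fin m → ℝ → ℝ) (p : Fin n → ℝ) : ℝ :=
  Finset.univ.inf' ⟨fun _ => ⟨0, hm⟩, Finset.mem_univ _⟩ (makespan hm A p)

theorem strictMonoOn_of_slope_lower_bound {A : ℝ → ℝ} {e : ℝ} (he : 0 < e)
    (h : ∀ s t : ℝ, 0 ≤ s → s ≤ t → e * (t - s) ≤ A t - A s) :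
    StrictMonoOn A (Set.Ici (0 : ℝ)) := by
  intro s hs t _ hst
  have h1 := h s t hs hst.le
  have h2 : 0 < e * (t - s) := mul_pos he (sub_pos.2 hst)
  linarith

theorem tendsto_atTop_of_slope_lower_bound {A : ℝ → ℝ} {e : ℝ} (he : 0 < e)
    (h : ∀ s t : ℝ, 0 ≤ s → s ≤ t → e * (t - s) ≤ A t - A s) :
    Filter.Tendsto A Filter.atTop Filter.atTop := by
  have h1 : Filter.Tendsto (fun t : ℝ => e * t + A 0) Filter.atTop Filter.atTop :=
    Filter.tendsto_atTop_add_const_right _ _ (Filter.tendsto_id.const_mul_atTop he)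
  refine Filter.tendsto_atTop_mono' _ ?_ h1
  filter_upwards [Filter.eventually_ge_atTop (0 : ℝ)] with t ht
  have := h 0 t le_rfl ht
  rw [sub_zero] at this
  linarith

theorem continuousOn_of_monotoneOn_of_slope_le_one {A : ℝ → ℝ}
    (hmono : MonotoneOn A (Set.Ici (0 : ℝ)))
    (h : ∀ s t : ℝ, 0 ≤ s → s ≤ t → A t - A s ≤ t - s) :
    ContinuousOn A (Set.Ici (0 : ℝ)) := by
  have hle : ∀ s t : ℝ, 0 ≤ s → s ≤ t → |A s - A t| ≤ |s - t| := by
    intro s t hs hst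
    rw [abs_sub_comm, abs_sub_comm s, abs_of_nonneg (sub_nonneg.2 hst),
      abs_of_nonneg (sub_nonneg.2 (hmono hs (hs.trans hst) hst))]
    exact h s t hs hst
  refine LipschitzOnWith.continuousOn (K := 1) (LipschitzOnWith.of_dist_le_mul ?_)
  intro x hx y hy
  rw [Real.dist_eq, Real.dist_eq, NNReal.coe_one, one_mul]
  rcases le_total x y with hxy | hxy
  · exact hle x y hx hxy
  · rw [abs_sub_comm, abs_sub_comm x]
    exact hle y x hy hxy

theorem finish_spec {A : ℝ → ℝ} (h0 : A 0 = 0) (hmono : StrictMonoOn A (Set.Ici (0 : ℝ)))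
    (hcont : ContinuousOn A (Set.Ici (0 : ℝ)))
    (htop : Filter.Tendsto A Filter.atTop Filter.atTop) {w : ℝ} (hw : 0 ≤ w) :
    0 ≤ finish A w ∧ A (finish A w) = w := by
  obtain ⟨T, hwT, hT⟩ :=
    ((htop.eventually_ge_atTop w).and (Filter.eventually_ge_atTop (0 : ℝ))).exists
  obtain ⟨t, ht, rfl⟩ := intermediate_value_Icc hT (hcont.mono Set.Icc_subset_Ici_self)
    (show w ∈ Set.Icc (A 0) (A T) from ⟨h0.trans_le hw, hwT⟩)
  have hset : {s : ℝ | 0 ≤ s ∧ A t ≤ A s} = Set.Ici t := by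
    ext s
    constructor
    · rintro ⟨hs, hts⟩
      exact (hmono.le_iff_le ht.1 hs).1 hts
    · intro hs
      exact ⟨ht.1.trans hs, (hmono.le_iff_le ht.1 (ht.1.trans hs)).2 hs⟩
  have hfin : finish A (A t) = t := by rw [finish, hset, csInf_Ici]
  rw [hfin]
  exact ⟨ht.1, rfl⟩

theorem sum_load {n m : ℕ} (p : Fin n → ℝ) (σ : Fin n → Fin m) :
    ∑ i, load p σ i = ∑ j, p j :=
  Finset.sum_fiberwise _ _ _

theorem sum_prefLoad {n m : ℕ} (p : Fin n → ℝ) (σ : Fin n → Fin m) (k : Fin n) :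
    ∑ i, prefLoad p σ i k = ∑ j ∈ Finset.Iio k, p j := by
  rw [← Finset.sum_fiberwise (Finset.Iio k) σ p]
  refine Finset.sum_congr rfl fun i _ => Finset.sum_congr ?_ fun _ _ => rfl
  ext j
  simp

theorem load_eq_prefLoad_add {n m : ℕ} (p : Fin n → ℝ) (σ : Fin n → Fin m) (k : Fin n)
    (hk : ∀ j, σ j = σ k → j ≤ k) : load p σ (σ k) = prefLoad p σ (σ k) k + p k := by
  have h : Finset.univ.filter (fun j => σ j = σ k)
      = insert k (Finset.univ.filter (fun j => j < k ∧ σ j = σ k)) := by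
    ext j
    simp only [Finset.mem_filter, Finset.mem_univ, true_and, Finset.mem_insert]
    constructor
    · intro hj
      exact (hk j hj).eq_or_lt.imp id fun h => ⟨h, hj⟩
    · rintro (rfl | h)
      · rfl
      · exact h.2
  rw [load, prefLoad, h, Finset.sum_insert (by simp), add_comm]

theorem mul_slope_le_sum_increment {m m1 : ℕ} (hm1m : m1 ≤ m) {A : Fin m → ℝ → ℝ} {e s t : ℝ}
    (hmono : ∀ i, A i s ≤ A i t)
    (hlo : ∀ i : Fin m, (i : ℕ) < m1 → e * (t - s) ≤ A i t - A i s) :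
    (m1 : ℝ) * (e * (t - s)) ≤ ∑ i, (A i t - A i s) := by
  calc (m1 : ℝ) * (e * (t - s))
      = ∑ i ∈ Finset.univ.filter (fun i : Fin m => (i : ℕ) < m1), e * (t - s) := by
        rw [Finset.sum_const, nsmul_eq_mul, Fin.card_filter_val_lt, min_eq_right hm1m]
    _ ≤ ∑ i ∈ Finset.univ.filter (fun i : Fin m => (i : ℕ) < m1), (A i t - A i s) :=
        Finset.sum_le_sum fun i hi => hlo i (Finset.mem_filter.1 hi).2
    _ ≤ ∑ i, (A i t - A i s) :=
        Finset.sum_le_sum_of_subset_of_nonneg (Finset.filter_subset _ _)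
          fun i _ _ => sub_nonneg.2 (hmono i)

theorem stmt_12 (e0 : ℝ) (he0 : 0 < e0) (he0' : e0 ≤ 1)
    (m m1 n : ℕ) (hm1 : 1 ≤ m1) (hm1m : m1 ≤ m)
    (A : Fin m → ℝ → ℝ) (hA0 : ∀ i, A i 0 = 0)
    (hAub : ∀ i, ∀ s t : ℝ, 0 ≤ s → s ≤ t → A i t - A i s ≤ t - s)
    (hAlo : ∀ i : Fin m, (i : ℕ) < m1 →
      ∀ s t : ℝ, 0 ≤ s → s ≤ t → e0 * (t - s) ≤ A i t - A i s)
    (hmono : ∀ i : Fin m, m1 ≤ (i : ℕ) → StrictMonoOn (A i) (Set.Ici (0 : ℝ)))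
    (htop : ∀ i : Fin m, m1 ≤ (i : ℕ) → Filter.Tendsto (A i) Filter.atTop Filter.atTop)
    (p : Fin n → ℝ) (hp : ∀ j, 0 < p j)
    (hLPT : ∀ j k : Fin n, j ≤ k → p k ≤ p j)
    (d : ℕ) (hd1 : 1 ≤ d) (hdn : d ≤ n)
    (σstar : Fin n → Fin m)
    (hopt : makespan (lt_of_lt_of_le hm1 hm1m) A p σstar
      = optMakespan (lt_of_lt_of_le hm1 hm1m) A p)
    (σ : Fin n → Fin m)
    (hagree : ∀ k : Fin n, (k : ℕ) < d → σ k = σstar k)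
    (hECT : ∀ k : Fin n, d ≤ (k : ℕ) → ∀ i : Fin m,
      finish (A (σ k)) (prefLoad p σ (σ k) k + p k) ≤ finish (A i) (prefLoad p σ i k + p k)) :
    makespan (lt_of_lt_of_le hm1 hm1m) A p σ
      ≤ (1 + (m : ℝ) * ((m : ℝ) + (m1 : ℝ) - 1) / ((d : ℝ) * e0 * (m1 : ℝ)))
          * optMakespan (lt_of_lt_of_le hm1 hm1m) A p := by
  have hm : 0 < m := lt_of_lt_of_le hm1 hm1m
  rw [← hopt]
  have hslope : ∀ i, StrictMonoOn (A i) (Set.Ici (0 : ℝ)) ∧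
      Filter.Tendsto (A i) Filter.atTop Filter.atTop := by
    intro i
    rcases lt_or_ge (i : ℕ) m1 with hi | hi
    · exact ⟨strictMonoOn_of_slope_lower_bound he0 (hAlo i hi),
        tendsto_atTop_of_slope_lower_bound he0 (hAlo i hi)⟩
    · exact ⟨hmono i hi, htop i hi⟩
  have hspec : ∀ i w, 0 ≤ w → 0 ≤ finish (A i) w ∧ A i (finish (A i) w) = w := fun i w hw =>
    finish_spec (hA0 i) (hslope i).1
      (continuousOn_of_monotoneOn_of_slope_le_one (hslope i).1.monotoneOn (hAub i))
      (hslope i).2 hw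
  have hload : ∀ (τ : Fin n → Fin m) i, 0 ≤ load p τ i := fun τ i => Finset.sum_nonneg fun j _ => (hp j).le
  have hpref : ∀ i k, 0 ≤ prefLoad p σ i k := fun i k => Finset.sum_nonneg fun j _ => (hp j).le
  set C := makespan (lt_of_lt_of_le hm1 hm1m) A p σstar
  have hfinC : ∀ i, finish (A i) (load p σstar i) ≤ C := fun i =>
    Finset.le_sup' (fun i => finish (A i) (load p σstar i)) (Finset.mem_univ i)
  have hC0 : 0 ≤ C := (hspec ⟨0, hm⟩ _ (hload _ _)).1.trans (hfinC _)
  have hloadC : ∀ i, load p σstar i ≤ A i C := by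
    intro i
    obtain ⟨h0, h1⟩ := hspec i _ (hload σstar i)
    calc load p σstar i = A i (finish (A i) (load p σstar i)) := h1.symm
      _ ≤ A i C := (hslope i).1.monotoneOn h0 hC0 (hfinC i)
  have hmR : (1 : ℝ) ≤ m := by exact_mod_cast hm
  have hm1R : (1 : ℝ) ≤ m1 := by exact_mod_cast hm1
  have hdR : (1 : ℝ) ≤ d := by exact_mod_cast hd1
  have hden : 0 < (d : ℝ) * e0 * (m1 : ℝ) := by positivity
  have hratio : 0 ≤ (m : ℝ) * ((m : ℝ) + (m1 : ℝ) - 1) / ((d : ℝ) * e0 * (m1 : ℝ)) :=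
    div_nonneg (mul_nonneg (by linarith) (by linarith)) hden.le
  refine Finset.sup'_le _ _ fun i _ => ?_
  rcases le_or_gt (finish (A i) (load p σ i)) C with hle | hgt
  · exact hle.trans (le_mul_of_one_le_left hC0 (by linarith))
  -- Some job beyond the first `d` runs on machine `i`, since `σ` and `σstar` agree before that.
  have hex : ∃ j, σ j = i ∧ d ≤ (j : ℕ) := by
    by_contra! hno
    refine hgt.not_ge (((hslope i).1.le_iff_le (hspec i _ (hload σ i)).1 hC0).1 ?_)
    rw [(hspec i _ (hload σ i)).2]
    refine le_trans ?_ (hloadC i)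
    refine Finset.sum_le_sum_of_subset_of_nonneg ?_ fun j _ _ => (hp j).le
    intro j hj
    have hj' := (Finset.mem_filter.1 hj).2
    exact Finset.mem_filter.2 ⟨Finset.mem_univ _, (hagree j (hno j hj')) ▸ hj'⟩
  obtain ⟨j, hji, hdj⟩ := hex
  obtain ⟨k, hki, hkmax⟩ :=
    (Finset.univ.filter (fun j => σ j = i)).exists_max_image id
      ⟨j, Finset.mem_filter.2 ⟨Finset.mem_univ _, hji⟩⟩
  have hσk : σ k = i := (Finset.mem_filter.1 hki).2
  have hlast : ∀ j, σ j = i → j ≤ k := fun j hj =>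
    hkmax j (Finset.mem_filter.2 ⟨Finset.mem_univ _, hj⟩)
  have hdk : d ≤ (k : ℕ) := hdj.trans (hlast j hji)
  subst hσk
  have hloadk := load_eq_prefLoad_add p σ k hlast
  set F := finish (A (σ k)) (load p σ (σ k)) with hF
  have hF0 : 0 ≤ F := hC0.trans hgt.le
  have hAF : ∀ i, A i F ≤ prefLoad p σ i k + p k := by
    intro i
    obtain ⟨h0, h1⟩ := hspec i _ (add_nonneg (hpref i k) (hp k).le)
    refine le_of_le_of_eq ((hslope i).1.monotoneOn hF0 h0 ?_) h1
    rw [hF, hloadk]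
    exact hECT k hdk i
  have hsumF : ∑ i, A i F ≤ ∑ j ∈ Finset.Iio k, p j + m * p k := by
    refine (Finset.sum_le_sum fun i _ => hAF i).trans_eq ?_
    rw [Finset.sum_add_distrib, sum_prefLoad]
    simp
  have hsumC : ∑ j, p j ≤ ∑ i, A i C := by
    rw [← sum_load p σstar]
    exact Finset.sum_le_sum fun i _ => hloadC i
  have hsumC' : ∑ i, A i C ≤ m * C := by
    refine (Finset.sum_le_sum fun i _ =>
      show A i C ≤ C by simpa [hA0 i] using hAub i 0 C le_rfl hC0).trans_eq ?_
    simp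
  have hprefix : ∑ j ∈ Finset.Iio k, p j + p k ≤ ∑ j, p j := by
    rw [add_comm, ← Finset.sum_insert (by simp)]
    exact Finset.sum_le_sum_of_subset_of_nonneg (Finset.subset_univ _) fun j _ _ => (hp j).le
  have hsmall : (d : ℝ) * p k ≤ ∑ j ∈ Finset.Iio k, p j := by
    have h := Finset.card_nsmul_le_sum (Finset.Iio k) p (p k)
      fun j hj => hLPT j k (Finset.mem_Iio.1 hj).le
    rw [Fin.card_Iio, nsmul_eq_mul] at h
    exact (mul_le_mul_of_nonneg_right (by exact_mod_cast hdk) (hp k).le).trans h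
  have hgap : (m1 : ℝ) * (e0 * (F - C)) ≤ (m - 1) * p k := by
    have h := mul_slope_le_sum_increment (e := e0) hm1m
      (fun i => (hslope i).1.monotoneOn hC0 hF0 hgt.le)
      (fun i hi => hAlo i hi C F hC0 hgt.le)
    rw [Finset.sum_sub_distrib] at h
    linarith
  have hpk : (d : ℝ) * p k ≤ m * C := by linarith [hp k]
  have hfinal : (F - C) * ((d : ℝ) * e0 * m1) ≤ m * (m + m1 - 1) * C := by
    calc (F - C) * ((d : ℝ) * e0 * m1) = d * ((m1 : ℝ) * (e0 * (F - C))) := by ring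
      _ ≤ d * ((m - 1) * p k) := by gcongr
      _ = (m - 1) * (d * p k) := by ring
      _ ≤ (m - 1) * (m * C) := mul_le_mul_of_nonneg_left hpk (by linarith)
      _ ≤ (m + m1 - 1) * (m * C) :=
        mul_le_mul_of_nonneg_right (by linarith) (by positivity)
      _ = m * (m + m1 - 1) * C := by ring
  have hdiv := (le_div_iff₀ hden).2 hfinal
  rw [mul_div_right_comm] at hdiv
  linarith
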